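/- Let q ≥ 1, let a₂ > a₃ > 0, let λ : Fin q → ℝ with λᵢ ≠ 0 for all i, let γ : Fin q → ℝ, and let c ≥ −q·log 4. Define f : ℝ^q → ℝ by f(x) = Σᵢ γᵢ xᵢ + a₂ Σᵢ λᵢ² xᵢ² + a₃ Σ_{i≠j} λᵢ λⱼ xᵢ xⱼ, and let S = { x ∈ ℝ^q : 0 < xᵢ ≤ 4 for all i, and −Σᵢ log xᵢ ≤ c }. Then f attains its minimum on S at exactly one point of S. -/

import Mathlib

open Finset

/-- Completing the square: the cross terms form a square up to the diagonal. -/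
theorem sum_sum_ite_ne_mul {ι : Type*} [Fintype ι] [DecidableEq ι] (lam x : ι → ℝ) :
    (∑ i, ∑ j, if i ≠ j then lam i * lam j * x i * x j else 0) =
      (∑ i, lam i * x i) ^ 2 - ∑ i, lam i ^ 2 * x i ^ 2 := by
  rw [sq, Finset.sum_mul_sum, ← Finset.sum_sub_distrib]
  refine Finset.sum_congr rfl fun i _ => ?_
  have hdiag : lam i ^ 2 * x i ^ 2 =
      ∑ j, if i = j then lam i * x i * (lam j * x j) else 0 := by
    rw [Finset.sum_ite_eq Finset.univ i]
    simp only [Finset.mem_univ, if_true]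
    ring
  rw [hdiag, ← Finset.sum_sub_distrib]
  refine Finset.sum_congr rfl fun j _ => ?_
  by_cases h : i = j
  · simp [h]
  · simp only [ne_eq, h, not_false_eq_true, if_true, if_false]
    ring

theorem strictConvexOn_sum_mul_sq {ι : Type*} [Fintype ι] (w : ι → ℝ) (hw : ∀ i, 0 < w i) :
    StrictConvexOn ℝ Set.univ fun x : ι → ℝ => ∑ i, w i * x i ^ 2 := by
  refine ⟨convex_univ, fun x _ y _ hxy a b ha hb hab => ?_⟩
  obtain ⟨k, hk⟩ := Function.ne_iff.mp hxy
  have hdiff : 0 < ∑ i, w i * (x i - y i) ^ 2 :=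
    Finset.sum_pos' (fun i _ => mul_nonneg (hw i).le (sq_nonneg _))
      ⟨k, Finset.mem_univ k, mul_pos (hw k) (sq_pos_of_ne_zero (sub_ne_zero.mpr hk))⟩
  have hexp : (∑ i, w i * (a • x + b • y) i ^ 2) = a • (∑ i, w i * x i ^ 2) +
      b • (∑ i, w i * y i ^ 2) - a * b * ∑ i, w i * (x i - y i) ^ 2 := by
    obtain rfl : b = 1 - a := by linarith
    simp only [smul_eq_mul, Finset.mul_sum, ← Finset.sum_add_distrib, ← Finset.sum_sub_distrib,
      Pi.add_apply, Pi.smul_apply]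
    exact Finset.sum_congr rfl fun i _ => by ring
  have := mul_pos (mul_pos ha hb) hdiff
  linarith

theorem convexOn_sum_mul {ι : Type*} [Fintype ι] (w : ι → ℝ) :
    ConvexOn ℝ Set.univ fun x : ι → ℝ => ∑ i, w i * x i :=
  (dotProductBilin ℝ ℝ w).convexOn convex_univ

theorem convexOn_sq_sum_mul {ι : Type*} [Fintype ι] (w : ι → ℝ) :
    ConvexOn ℝ Set.univ fun x : ι → ℝ => (∑ i, w i * x i) ^ 2 :=
  (even_two.convexOn_pow (𝕜 := ℝ)).comp_linearMap (dotProductBilin ℝ ℝ w)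

/-- The quantization cost is strictly convex. -/
theorem strictConvexOn_quantization_cost {ι : Type*} [Fintype ι] [DecidableEq ι] {a₂ a₃ : ℝ}
    (ha₃ : 0 < a₃) (ha : a₃ < a₂) {lam : ι → ℝ} (hlam : ∀ i, lam i ≠ 0) (γ : ι → ℝ) :
    StrictConvexOn ℝ Set.univ fun x : ι → ℝ =>
      (∑ i, γ i * x i) + a₂ * ∑ i, (lam i) ^ 2 * (x i) ^ 2 +
        a₃ * ∑ i, ∑ j, if i ≠ j then lam i * lam j * x i * x j else 0 := by
  have hconv := ((convexOn_sum_mul γ).add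
    ((convexOn_sq_sum_mul lam).smul ha₃.le)).add_strictConvexOn
      (strictConvexOn_sum_mul_sq (fun i => (a₂ - a₃) * lam i ^ 2)
        fun i => mul_pos (sub_pos.mpr ha) (sq_pos_of_ne_zero (hlam i)))
  refine hconv.congr fun x _ => ?_
  simp only [sum_sum_ite_ne_mul]
  simp only [Pi.add_apply, smul_eq_mul, mul_assoc, ← Finset.mul_sum]
  ring

/-- The points of `(0, u]^ι` satisfying the logarithmic budget form a compact set: the budget
bounds every coordinate away from `0`. -/
theorem isCompact_log_budget {ι : Type*} [Fintype ι] (u c : ℝ) :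
    IsCompact {y : ι → ℝ | (∀ i, 0 < y i ∧ y i ≤ u) ∧ -∑ i, Real.log (y i) ≤ c} := by
  set m : ℝ := Real.exp (Real.log u - (Fintype.card ι * Real.log u + c))
  have hm : 0 < m := Real.exp_pos _
  have hset : {y : ι → ℝ | (∀ i, 0 < y i ∧ y i ≤ u) ∧ -∑ i, Real.log (y i) ≤ c} =
      Set.Icc (fun _ => m) (fun _ => u) ∩
        (fun y : ι → ℝ => -∑ i, Real.log (y i)) ⁻¹' Set.Iic c := by
    ext y
    constructor
    · rintro ⟨hy, hyc⟩
      refine ⟨⟨fun i => ?_, fun i => (hy i).2⟩, hyc⟩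
      have hle := Finset.single_le_sum (f := fun j => Real.log u - Real.log (y j))
        (fun j _ => sub_nonneg.mpr (Real.log_le_log (hy j).1 (hy j).2)) (Finset.mem_univ i)
      rw [Finset.sum_sub_distrib, Finset.sum_const, Finset.card_univ, nsmul_eq_mul] at hle
      exact (Real.le_log_iff_exp_le (hy i).1).mp (by linarith)
    · rintro ⟨⟨hmy, hyu⟩, hyc⟩
      exact ⟨fun i => ⟨hm.trans_le (hmy i), hyu i⟩, hyc⟩
  rw [hset]
  refine isCompact_Icc.of_isClosed_subset
    (ContinuousOn.preimage_isClosed_of_isClosed ?_ isClosed_Icc isClosed_Iic) Set.inter_subset_left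
  exact (continuousOn_finsetSum _ fun i _ => (continuous_apply i).continuousOn.log
    fun y hy => (hm.trans_le (hy.1 i)).ne').neg

theorem convex_log_budget {ι : Type*} [Fintype ι] (u c : ℝ) :
    Convex ℝ {y : ι → ℝ | (∀ i, 0 < y i ∧ y i ≤ u) ∧ -∑ i, Real.log (y i) ≤ c} := by
  rintro x ⟨hx, hxc⟩ y ⟨hy, hyc⟩ a b ha hb hab
  refine ⟨fun i => ⟨convex_Ioi (0 : ℝ) (hx i).1 (hy i).1 ha hb hab,
    convex_Iic u (hx i).2 (hy i).2 ha hb hab⟩, ?_⟩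
  have hlog : a * ∑ i, Real.log (x i) + b * ∑ i, Real.log (y i) ≤
      ∑ i, Real.log ((a • x + b • y) i) := by
    rw [Finset.mul_sum, Finset.mul_sum, ← Finset.sum_add_distrib]
    exact Finset.sum_le_sum fun i _ =>
      strictConcaveOn_log_Ioi.concaveOn.2 (hx i).1 (hy i).1 ha hb hab
  have hc : a * c + b * c = c := by rw [← add_mul, hab, one_mul]
  linarith [mul_le_mul_of_nonneg_left hxc ha, mul_le_mul_of_nonneg_left hyc hb]

/-- For each fixed `q`, the convex bit-allocation problem has a unique solution:
the strictly convex cost `f` attains its minimum on the nonempty compact convex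
feasible set `S` at exactly one point. -/
theorem exists_unique_minimizer_quantization_cost
    (q : ℕ) (hq : 1 ≤ q) (a₂ a₃ : ℝ) (ha₃ : 0 < a₃) (ha : a₃ < a₂)
    (lam : Fin q → ℝ) (hlam : ∀ i, lam i ≠ 0) (γ : Fin q → ℝ)
    (c : ℝ) (hc : -(q : ℝ) * Real.log 4 ≤ c)
    (f : (Fin q → ℝ) → ℝ)
    (hf : ∀ x, f x = (∑ i, γ i * x i) + a₂ * ∑ i, (lam i) ^ 2 * (x i) ^ 2 +
      a₃ * ∑ i, ∑ j, if i ≠ j then lam i * lam j * x i * x j else 0)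
    (S : Set (Fin q → ℝ))
    (hS : S = {y : Fin q → ℝ |
      (∀ i, 0 < y i ∧ y i ≤ 4) ∧ -∑ i, Real.log (y i) ≤ c}) :
    ∃! x : Fin q → ℝ, x ∈ S ∧ ∀ y ∈ S, f x ≤ f y := by
  have hconv : StrictConvexOn ℝ Set.univ f := by
    rw [funext hf]
    exact strictConvexOn_quantization_cost ha₃ ha hlam γ
  have hcont : Continuous f := by
    rw [funext hf]
    simp only [sum_sum_ite_ne_mul]
    fun_prop
  have hcomp : IsCompact S := hS ▸ isCompact_log_budget 4 c
  have hSconv : Convex ℝ S := hS ▸ convex_log_budget 4 c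
  have hne : S.Nonempty := by
    refine ⟨fun _ => 4, ?_⟩
    rw [hS]
    refine ⟨fun _ => ⟨by norm_num, le_rfl⟩, ?_⟩
    simpa using hc
  obtain ⟨x, hxS, hx⟩ := hcomp.exists_isMinOn hne hcont.continuousOn
  refine ⟨x, ⟨hxS, fun y hy => hx hy⟩, fun y hy => ?_⟩
  exact (hconv.subset (Set.subset_univ S) hSconv).eq_of_isMinOn (fun z hz => hy.2 z hz) hx hy.1 hxS
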